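/- arXiv:2504.08484 — 2 statements merged into one kernel-verified Lean document; each statement's English description precedes it below -/
import Mathlib

section
/- (Multi-bound interpolation.) Let N ≥ 1, let m : Fin N → ℕ be block sizes, let Y be a real n×t matrix, for each i let Zᵢ be a real (m i)×t matrix, and for each i let Γᵢ be a symmetric positive semidefinite (m i)×(m i) real matrix. Let Z be the vertically stacked matrix indexed by Σ i, Fin (m i), whose i-th row block is Zᵢ. Then there exist real n×(m i) matrices Mᵢ satisfying Y = Σᵢ Mᵢ·Zᵢ and Mᵢᵀ·Mᵢ ⪯ Γᵢ for all i, if and only if there exists a symmetric positive semidefinite matrix Ĝ indexed by Σ i, Fin (m i) whose (i,i) diagonal block equals Γᵢ for every i and such that Yᵀ·Y ⪯ Zᵀ·Ĝ·Z. -/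
open Matrix

/-- **Douglas factorization lemma**: a linear map `g` dominated in norm by `f` factors as a
contraction composed with `f`. -/
theorem LinearMap.exists_contraction_comp_eq {E F G : Type*} [AddCommGroup E] [Module ℝ E]
    [NormedAddCommGroup F] [InnerProductSpace ℝ F] [FiniteDimensional ℝ F]
    [NormedAddCommGroup G] [NormedSpace ℝ G]
    (f : E →ₗ[ℝ] F) (g : E →ₗ[ℝ] G) (hfg : ∀ x, ‖g x‖ ≤ ‖f x‖) :
    ∃ h : F →ₗ[ℝ] G, h ∘ₗ f = g ∧ ∀ y, ‖h y‖ ≤ ‖y‖ := by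
  obtain ⟨s, hs⟩ := f.rangeRestrict.exists_rightInverse_of_surjective f.range_rangeRestrict
  have hs' (y : f.range) : f (s y) = y := congrArg Subtype.val (LinearMap.congr_fun hs y)
  refine ⟨g ∘ₗ s ∘ₗ f.range.orthogonalProjectionOnto.toLinearMap, ?_, fun y => ?_⟩
  · ext x
    have hx : f.range.orthogonalProjectionOnto (f x) = ⟨f x, f.mem_range_self x⟩ :=
      Submodule.orthogonalProjectionOnto_mem_subspace_eq_self ⟨f x, f.mem_range_self x⟩
    have hker := hfg (s ⟨f x, f.mem_range_self x⟩ - x)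
    rw [map_sub f, hs', sub_self, norm_zero, norm_le_zero_iff, map_sub, sub_eq_zero] at hker
    simpa [hx] using hker
  · calc ‖g (s (f.range.orthogonalProjectionOnto y))‖
        ≤ ‖f (s (f.range.orthogonalProjectionOnto y))‖ := hfg _
      _ = ‖f.range.orthogonalProjectionOnto y‖ := by rw [hs']; rfl
      _ ≤ ‖y‖ := f.range.norm_orthogonalProjectionOnto_apply_le y

namespace Matrix

theorem mul_eq_sum_sigma {n t ι : Type*} [Fintype ι] {k : ι → Type*} [∀ i, Fintype (k i)]
    (F : Matrix n (Σ i, k i) ℝ) (Z : Matrix (Σ i, k i) t ℝ) :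
    F * Z = ∑ i, F.submatrix id (Sigma.mk i) * Z.submatrix (Sigma.mk i) id := by
  ext a b
  simp [mul_apply, sum_apply, Fintype.sum_sigma]

variable {m n t : Type*} [Fintype m] [Fintype n] [Fintype t]

theorem dotProduct_transpose_mul_self_mulVec [DecidableEq t] (A : Matrix m t ℝ) (x : t → ℝ) :
    x ⬝ᵥ (Aᵀ * A) *ᵥ x = ‖A.toEuclideanLin (WithLp.toLp 2 x)‖ ^ 2 := by
  rw [EuclideanSpace.real_norm_sq_eq, ← mulVec_mulVec, dotProduct_mulVec, vecMul_transpose]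
  simp [dotProduct, sq]

theorem posSemidef_transpose_mul_self_sub_iff [DecidableEq t]
    (A : Matrix m t ℝ) (Y : Matrix n t ℝ) :
    (Aᵀ * A - Yᵀ * Y).PosSemidef ↔
      ∀ x, ‖Y.toEuclideanLin x‖ ≤ ‖A.toEuclideanLin x‖ := by
  have hherm : (Aᵀ * A - Yᵀ * Y).IsHermitian := by
    simp [IsHermitian, conjTranspose_eq_transpose_of_trivial]
  have key (x : t → ℝ) : 0 ≤ star x ⬝ᵥ (Aᵀ * A - Yᵀ * Y) *ᵥ x ↔
      ‖Y.toEuclideanLin (WithLp.toLp 2 x)‖ ≤ ‖A.toEuclideanLin (WithLp.toLp 2 x)‖ := by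
    rw [star_trivial, sub_mulVec, dotProduct_sub, dotProduct_transpose_mul_self_mulVec,
      dotProduct_transpose_mul_self_mulVec, sub_nonneg,
      sq_le_sq₀ (norm_nonneg _) (norm_nonneg _)]
  rw [posSemidef_iff_dotProduct_mulVec, and_iff_right hherm]
  exact ⟨fun h x => (key x.ofLp).1 (h _), fun h x => (key x).2 (h _)⟩

/-- Matrix form of the Douglas factorization lemma. -/
theorem exists_contraction_mul_eq [DecidableEq m] [DecidableEq t]
    {A : Matrix m t ℝ} {Y : Matrix n t ℝ} (h : (Aᵀ * A - Yᵀ * Y).PosSemidef) :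
    ∃ C : Matrix n m ℝ, Y = C * A ∧ (1 - Cᵀ * C).PosSemidef := by
  obtain ⟨c, hc, hcn⟩ := LinearMap.exists_contraction_comp_eq A.toEuclideanLin Y.toEuclideanLin
    ((posSemidef_transpose_mul_self_sub_iff A Y).1 h)
  obtain ⟨C, rfl⟩ := (toEuclideanLin (𝕜 := ℝ) (m := n) (n := m)).surjective c
  refine ⟨C, (toEuclideanLin (𝕜 := ℝ)).injective ?_, ?_⟩
  · rw [toLpLin_mul_same, hc]
  · have hC := (posSemidef_transpose_mul_self_sub_iff (1 : Matrix m m ℝ) C).2 fun x => by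
      rw [toLpLin_one]
      exact hcn x
    rwa [transpose_one, one_mul] at hC

open scoped MatrixOrder in
theorem PosSemidef.exists_eq_transpose_mul_self [DecidableEq m] {A : Matrix m m ℝ}
    (hA : A.PosSemidef) : ∃ B : Matrix m m ℝ, A = Bᵀ * B := by
  obtain ⟨B, hB⟩ := CStarAlgebra.nonneg_iff_eq_star_mul_self.mp hA.nonneg
  exact ⟨B, hB⟩

theorem PosSemidef.blockDiagonal' {ι : Type*} [Fintype ι] [DecidableEq ι] {k : ι → Type*}
    [∀ i, Fintype (k i)] [∀ i, DecidableEq (k i)] {D : ∀ i, Matrix (k i) (k i) ℝ}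
    (hD : ∀ i, (D i).PosSemidef) : (Matrix.blockDiagonal' D).PosSemidef := by
  choose B hB using fun i => (hD i).exists_eq_transpose_mul_self
  rw [funext hB, blockDiagonal'_mul, ← blockDiagonal'_transpose]
  exact posSemidef_conjTranspose_mul_self _

end Matrix

/-- Proposition 3, multi-bound interpolation: there exist blocks `Mᵢ` with
`Y = ∑ᵢ Mᵢ Zᵢ` and `Mᵢᵀ Mᵢ ⪯ Γᵢ` iff there exists a PSD completion `Ghat` of the block-diagonal
specification `(Γᵢ)ᵢ` such that `Yᵀ Y ⪯ Zᵀ Ghat Z`, where `Z` stacks the `Zᵢ` vertically. -/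
theorem stmt_7 {N n t : ℕ} (hN : 1 ≤ N) (m : Fin N → ℕ)
    (Y : Matrix (Fin n) (Fin t) ℝ)
    (Zs : ∀ i, Matrix (Fin (m i)) (Fin t) ℝ)
    (Γ : ∀ i, Matrix (Fin (m i)) (Fin (m i)) ℝ) (hΓ : ∀ i, (Γ i).PosSemidef) :
    letI Z : Matrix ((i : Fin N) × Fin (m i)) (Fin t) ℝ :=
      Matrix.of fun p k => Zs p.1 p.2 k
    (∃ M : ∀ i, Matrix (Fin n) (Fin (m i)) ℝ,
        Y = ∑ i, M i * Zs i ∧ ∀ i, (Γ i - (M i)ᵀ * M i).PosSemidef) ↔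
      ∃ Ghat : Matrix ((i : Fin N) × Fin (m i)) ((i : Fin N) × Fin (m i)) ℝ,
        Ghat.PosSemidef ∧ (∀ (i : Fin N) (j k : Fin (m i)), Ghat ⟨i, j⟩ ⟨i, k⟩ = Γ i j k) ∧
          (Zᵀ * Ghat * Z - Yᵀ * Y).PosSemidef := by
  let Z : Matrix ((i : Fin N) × Fin (m i)) (Fin t) ℝ := of fun p k => Zs p.1 p.2 k
  constructor
  · rintro ⟨M, hY, hM⟩
    let F : Matrix (Fin n) ((i : Fin N) × Fin (m i)) ℝ := of fun a p => M p.1 a p.2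
    have hF : Y = F * Z := hY.trans (mul_eq_sum_sigma F Z).symm
    have hD := PosSemidef.blockDiagonal' hM
    refine ⟨Fᵀ * F + blockDiagonal' fun i => Γ i - (M i)ᵀ * M i,
      (posSemidef_conjTranspose_mul_self F).add hD, fun i j k => ?_, ?_⟩
    · simp [blockDiagonal'_apply_eq, mul_apply, F]
    · have hZ := hD.conjTranspose_mul_mul_same Z
      rw [conjTranspose_eq_transpose_of_trivial] at hZ
      convert hZ using 1
      rw [hF, transpose_mul]
      simp only [Matrix.mul_add, Matrix.add_mul, Matrix.mul_assoc]
      exact add_sub_cancel_left _ _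
  · rintro ⟨G, hG, hGΓ, hGZ⟩
    obtain ⟨R, rfl⟩ := hG.exists_eq_transpose_mul_self
    have hRZ : ((R * Z)ᵀ * (R * Z) - Yᵀ * Y).PosSemidef := by
      simpa only [transpose_mul, Matrix.mul_assoc] using hGZ
    obtain ⟨C, hY, hC⟩ := exists_contraction_mul_eq hRZ
    refine ⟨fun i => (C * R).submatrix id fun j => ⟨i, j⟩, ?_, fun i => ?_⟩
    · rw [hY, ← Matrix.mul_assoc]
      exact mul_eq_sum_sigma (C * R) Z
    · have hR := (hC.conjTranspose_mul_mul_same R).submatrix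
        fun j : Fin (m i) => (⟨i, j⟩ : (i : Fin N) × Fin (m i))
      rw [conjTranspose_eq_transpose_of_trivial, Matrix.mul_sub, Matrix.sub_mul, Matrix.mul_one,
        Matrix.mul_assoc Rᵀ, Matrix.mul_assoc Cᵀ, ← Matrix.mul_assoc Rᵀ, ← transpose_mul] at hR
      convert hR using 1
      ext j k
      rw [submatrix_apply, Matrix.sub_apply, Matrix.sub_apply, hGΓ]
      rfl
end

section
/- (No-data prediction set is a ball.) Let B be a real n×m matrix, L > 0, x ∈ ℝⁿ and u ∈ ℝ^m. Then { A·x + B·u : A is a real n×n matrix with Aᵀ·A ⪯ L²·Iₙ } = { y ∈ ℝⁿ : ‖y − B·u‖₂ ≤ L·‖x‖₂ }, the closed Euclidean ball of center B·u and radius L·‖x‖₂. -/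
open Matrix

theorem posSemidef_smul_one_sub_transpose_mul_self_iff {m n : Type*} [Fintype m] [Fintype n]
    [DecidableEq n] (A : Matrix m n ℝ) (c : ℝ) :
    (c • (1 : Matrix n n ℝ) - Aᵀ * A).PosSemidef ↔
      ∀ v : n → ℝ, (A *ᵥ v) ⬝ᵥ (A *ᵥ v) ≤ c * (v ⬝ᵥ v) := by
  have quad (v : n → ℝ) : v ⬝ᵥ ((c • (1 : Matrix n n ℝ) - Aᵀ * A) *ᵥ v) =
      c * (v ⬝ᵥ v) - (A *ᵥ v) ⬝ᵥ (A *ᵥ v) := by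
    rw [sub_mulVec, dotProduct_sub, smul_mulVec, one_mulVec, dotProduct_smul, smul_eq_mul,
      ← mulVec_mulVec, dotProduct_mulVec v Aᵀ, vecMul_transpose]
  have herm : (c • (1 : Matrix n n ℝ) - Aᵀ * A).IsHermitian := by
    simp [IsHermitian, conjTranspose_eq_transpose_of_trivial]
  rw [posSemidef_iff_dotProduct_mulVec]
  simp only [herm, true_and, star_trivial, quad, sub_nonneg]

theorem sq_dotProduct_le {n : Type*} [Fintype n] (v w : n → ℝ) :
    (v ⬝ᵥ w) ^ 2 ≤ (v ⬝ᵥ v) * (w ⬝ᵥ w) := by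
  simpa [dotProduct, sq] using Finset.sum_mul_sq_le_sq_mul_sq Finset.univ v w

theorem sqrt_dotProduct_self_le_iff {m n : Type*} [Fintype m] [Fintype n] {L : ℝ} (hL : 0 ≤ L)
    (w : m → ℝ) (x : n → ℝ) :
    Real.sqrt (w ⬝ᵥ w) ≤ L * Real.sqrt (x ⬝ᵥ x) ↔ w ⬝ᵥ w ≤ L ^ 2 * (x ⬝ᵥ x) := by
  have hx : 0 ≤ x ⬝ᵥ x := by simpa using dotProduct_star_self_nonneg x
  rw [Real.sqrt_le_left (by positivity), mul_pow, Real.sq_sqrt hx]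

theorem exists_mulVec_eq_of_dotProduct_self_le {m n : Type*} [Fintype m] [Fintype n] {c : ℝ}
    (hc : 0 ≤ c) (w : m → ℝ) (x : n → ℝ) (h : w ⬝ᵥ w ≤ c * (x ⬝ᵥ x)) :
    ∃ A : Matrix m n ℝ, A *ᵥ x = w ∧
      ∀ v : n → ℝ, (A *ᵥ v) ⬝ᵥ (A *ᵥ v) ≤ c * (v ⬝ᵥ v) := by
  have nonneg (v : n → ℝ) : 0 ≤ v ⬝ᵥ v := by simpa using dotProduct_star_self_nonneg v
  rcases eq_or_ne x 0 with rfl | hx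
  · have hw : w = 0 := by
      refine dotProduct_self_eq_zero.1 (le_antisymm (by simpa using h) ?_)
      simpa using dotProduct_star_self_nonneg w
    exact ⟨0, by simp [hw], fun v => by simpa using mul_nonneg hc (nonneg v)⟩
  · have hxx : 0 < x ⬝ᵥ x := (nonneg x).lt_of_ne' fun h0 => hx (dotProduct_self_eq_zero.1 h0)
    have apply_eq (v : n → ℝ) :
        ((x ⬝ᵥ x)⁻¹ • vecMulVec w x) *ᵥ v = ((x ⬝ᵥ x)⁻¹ * (x ⬝ᵥ v)) • w := by
      rw [smul_mulVec, vecMulVec_mulVec, op_smul_eq_smul, smul_smul]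
    refine ⟨(x ⬝ᵥ x)⁻¹ • vecMulVec w x, ?_, fun v => ?_⟩
    · rw [apply_eq, inv_mul_cancel₀ hxx.ne', one_smul]
    · rw [apply_eq, smul_dotProduct, dotProduct_smul, smul_eq_mul, smul_eq_mul]
      calc (x ⬝ᵥ x)⁻¹ * (x ⬝ᵥ v) * ((x ⬝ᵥ x)⁻¹ * (x ⬝ᵥ v) * (w ⬝ᵥ w))
          = ((x ⬝ᵥ x)⁻¹) ^ 2 * ((x ⬝ᵥ v) ^ 2 * (w ⬝ᵥ w)) := by ring
        _ ≤ ((x ⬝ᵥ x)⁻¹) ^ 2 * (((x ⬝ᵥ x) * (v ⬝ᵥ v)) * (c * (x ⬝ᵥ x))) := by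
          have hv := nonneg v
          have hw : 0 ≤ w ⬝ᵥ w := by simpa using dotProduct_star_self_nonneg w
          gcongr
          exact sq_dotProduct_le x v
        _ = c * (v ⬝ᵥ v) := by field_simp

/-- with no data, the one-step reachable set
`{A x + B u : Aᵀ A ⪯ L² I}` is the closed Euclidean ball of center `B u` and radius
`L ‖x‖₂`. -/
theorem stmt_13 {n md : ℕ} (B : Matrix (Fin n) (Fin md) ℝ) (L : ℝ) (hL : 0 < L)
    (x : Fin n → ℝ) (u : Fin md → ℝ) :
    {y : Fin n → ℝ | ∃ A : Matrix (Fin n) (Fin n) ℝ,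
        (L ^ 2 • (1 : Matrix (Fin n) (Fin n) ℝ) - Aᵀ * A).PosSemidef ∧
        y = A *ᵥ x + B *ᵥ u} =
      {y : Fin n → ℝ |
        Real.sqrt ((y - B *ᵥ u) ⬝ᵥ (y - B *ᵥ u)) ≤ L * Real.sqrt (x ⬝ᵥ x)} := by
  ext y
  simp only [Set.mem_ofPred_eq, posSemidef_smul_one_sub_transpose_mul_self_iff,
    sqrt_dotProduct_self_le_iff hL.le]
  constructor
  · rintro ⟨A, hA, rfl⟩
    simpa using hA x
  · intro h
    obtain ⟨A, hAx, hA⟩ := exists_mulVec_eq_of_dotProduct_self_le (sq_nonneg L) _ x h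
    exact ⟨A, hA, by rw [hAx, sub_add_cancel]⟩
end
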